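/- arXiv:2501.14474 — 2 statements merged into one kernel-verified Lean document; each statement's English description precedes it below -/
import Mathlib

section
/- Assume r_j ≤ 1 for all outcomes j. There is an absolute constant A > 0 such that the following holds. Let ε, δ ∈ (0,1) and ρ ≥ 0, let C̄ ⊆ C ⊆ C_bounded be contract classes such that C̄ is an (ε/3)-approximation of C, and let d = PDim(C̄). If N ≥ A·(1/ε²)·(d + log(1/δ)), then for every finitely supported probability distribution D on Θ_all, with probability at least 1 − δ over an i.i.d. sample (θ_1,…,θ_N) ∼ D^N, every contract t ∈ C̄ satisfying (1/N)·Σ_{i≤N} u_p(θ_i, t) ≥ sup_{t'∈C̄} (1/N)·Σ_{i≤N} u_p(θ_i, t') − ρ also satisfies E_{θ∼D}[u_p(θ, t)] ≥ OPT(C, D) − ε − ρ. -/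
open scoped BigOperators

/-- An agent type in the hidden-action principal-agent model with `n` actions and
`m` outcomes: a production function `f` (a distribution over outcomes for each action)
and a nonnegative cost vector `c` with `c 0 = 0`. -/
structure AgentType (n m : ℕ) where
  f : Fin n → Fin m → ℝ
  c : Fin n → ℝ
  f_nonneg : ∀ i j, 0 ≤ f i j
  f_sum : ∀ i, ∑ j, f i j = 1
  c_nonneg : ∀ i, 0 ≤ c i
  c_zero : ∀ i : Fin n, (i : ℕ) = 0 → c i = 0

/-- The agent's expected utility for action `i` under contract `t`. -/
def uA {n m : ℕ} (θ : AgentType n m) (t : Fin m → ℝ) (i : Fin n) : ℝ :=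
  (∑ j, θ.f i j * t j) - θ.c i

/-- The principal's expected utility when the agent takes action `i` under contract `t`,
with rewards `r`. -/
def uPa {n m : ℕ} (r : Fin m → ℝ) (θ : AgentType n m) (t : Fin m → ℝ) (i : Fin n) : ℝ :=
  ∑ j, θ.f i j * (r j - t j)

/-- The set of the agent's best-response actions to contract `t`. -/
def BestResp {n m : ℕ} (θ : AgentType n m) (t : Fin m → ℝ) : Set (Fin n) :=
  {i | ∀ i', uA θ t i' ≤ uA θ t i}

/-- The principal's utility under contract `t`: the agent best-responds, breaking ties
in favor of the principal. -/
noncomputable def uP {n m : ℕ} (r : Fin m → ℝ) (θ : AgentType n m) (t : Fin m → ℝ) : ℝ :=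
  sSup (uPa r θ t '' BestResp θ t)

/-- The class of linear contracts `α • r`, `α ∈ [0,1]`. -/
def Clinear {m : ℕ} (r : Fin m → ℝ) : Set (Fin m → ℝ) :=
  {t | ∃ α : ℝ, α ∈ Set.Icc (0:ℝ) 1 ∧ t = fun j => α * r j}

/-- The class of bounded contracts `[0,1]^m`. -/
def Cbounded (m : ℕ) : Set (Fin m → ℝ) := {t | ∀ j, t j ∈ Set.Icc (0:ℝ) 1}

/-- The class of unbounded contracts `ℝ_{≥0}^m`. -/
def Cunbounded (m : ℕ) : Set (Fin m → ℝ) := {t | ∀ j, 0 ≤ t j}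

/-- A finitely supported probability distribution. -/
structure FinDist (α : Type*) where
  p : α → ℝ
  nonneg : ∀ a, 0 ≤ p a
  finite_support : (Function.support p).Finite
  total : ∑ᶠ a, p a = 1

/-- Expectation of `g` under a finitely supported distribution `D`. -/
noncomputable def expect {α : Type*} (D : FinDist α) (g : α → ℝ) : ℝ :=
  ∑ᶠ a, D.p a * g a

/-- `OPT(C, D)`: the supremum over contracts in `C` of the principal's expected utility. -/
noncomputable def OPT {n m : ℕ} (C : Set (Fin m → ℝ)) (r : Fin m → ℝ)
    (D : FinDist (AgentType n m)) : ℝ :=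
  sSup ((fun t => expect D (fun θ => uP r θ t)) '' C)

/-- Pseudo-dimension shattering: `C` shatters some `k` types in `Θ`. -/
def Shatters {n m : ℕ} (r : Fin m → ℝ) (C : Set (Fin m → ℝ))
    (Θ : Set (AgentType n m)) (k : ℕ) : Prop :=
  ∃ θ : Fin k → AgentType n m, (∀ j, θ j ∈ Θ) ∧ ∃ τ : Fin k → ℝ,
    ∀ S : Finset (Fin k), ∃ t ∈ C,
      (∀ j, j ∈ S → τ j ≤ uP r (θ j) t) ∧ (∀ j, j ∉ S → uP r (θ j) t < τ j)

/-- `Cbar` is an `ε`-approximation of `C` (representation error at most `ε`). -/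
def IsApprox (n : ℕ) {m : ℕ} (r : Fin m → ℝ) (Cbar C : Set (Fin m → ℝ)) (ε : ℝ) : Prop :=
  ∀ D : FinDist (AgentType n m), OPT Cbar r D ≥ OPT C r D - ε

/-- Best responses breaking ties in favor of the principal. -/
def BestRespP {n m : ℕ} (r : Fin m → ℝ) (θ : AgentType n m) (t : Fin m → ℝ) : Set (Fin n) :=
  {i | i ∈ BestResp θ t ∧ ∀ i' ∈ BestResp θ t, uPa r θ t i' ≤ uPa r θ t i}

/-- Principal's expected reward under the linear contract `α • r`. -/
noncomputable def rP {n m : ℕ} (r : Fin m → ℝ) (θ : AgentType n m) (α : ℝ) : ℝ :=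
  sSup ((fun i => ∑ j, θ.f i j * r j) '' BestRespP r θ (fun j => α * r j))

/-- The set of critical values of an agent type for linear contracts. -/
def CritSet {n m : ℕ} (r : Fin m → ℝ) (θ : AgentType n m) : Set ℝ :=
  {α | α ∈ Set.Ioc (0:ℝ) 1 ∧ ∀ ε : ℝ, 0 < ε → ε ≤ α → rP r θ (α - ε) ≠ rP r θ α}

/-- Probability of the event `E` under `N` i.i.d. samples from `D`. -/
noncomputable def prodProb {α : Type*} (D : FinDist α) (N : ℕ) (E : Set (Fin N → α)) : ℝ :=
  ∑ᶠ s ∈ E, ∏ i, D.p (s i)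

/-- The class of `ε`-discrete linear contracts. -/
def Leps {m : ℕ} (r : Fin m → ℝ) (ε : ℝ) : Set (Fin m → ℝ) :=
  {t | ∃ α : ℝ, ((∃ k : ℕ, α = k * ε ∧ k * ε ≤ 1) ∨ α = 1) ∧ t = fun j => α * r j}

open scoped Finset

/-- Probabilistic packing: few random points suffice to distinguish all members of a family whose
members pairwise disagree on a large fraction of the ground set. -/
lemma exists_separating_points {β Y : Type*} [Fintype Y] [Nonempty Y]
    (G : Finset β) (R : β → Y → Prop) [∀ a y, Decidable (R a y)] (η : ℝ) (hη1 : η ≤ 1)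
    (sep : ∀ a ∈ G, ∀ b ∈ G, a ≠ b →
      η * Fintype.card Y ≤ #(Finset.univ.filter fun y => ¬ (R a y ↔ R b y)))
    (hG : 0 < #G) (k : ℕ) (hk : 2 * Real.log #G ≤ η * k) :
    ∃ κ : Fin k → Y, ∀ a ∈ G, ∀ b ∈ G, (∀ l, R a (κ l) ↔ R b (κ l)) → a = b := by
  classical
  by_contra! hcon
  let agree : β × β → Finset Y := fun q => Finset.univ.filter fun y => (R q.1 y ↔ R q.2 y)
  have hcover : (Finset.univ : Finset (Fin k → Y)) ⊆
      G.offDiag.biUnion fun q => Fintype.piFinset fun _ => agree q := by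
    intro κ _
    obtain ⟨a, ha, b, hb, hl, hne⟩ := hcon κ
    simp only [Finset.mem_biUnion, Finset.mem_offDiag, Fintype.mem_piFinset, Prod.exists]
    exact ⟨a, b, ⟨ha, hb, hne⟩, fun l => by simpa [agree] using hl l⟩
  have hY : (0 : ℝ) < Fintype.card Y := by exact_mod_cast Fintype.card_pos
  have hagree : ∀ q ∈ G.offDiag, (#(agree q) : ℝ) ≤ (1 - η) * Fintype.card Y := by
    intro q hq
    rw [Finset.mem_offDiag] at hq
    have h1 := sep q.1 hq.1 q.2 hq.2.1 hq.2.2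
    have h2 : #(agree q) + #(Finset.univ.filter fun y => ¬ (R q.1 y ↔ R q.2 y))
        = Fintype.card Y := by
      rw [← Finset.card_univ]
      exact Finset.card_filter_add_card_filter_not (s := Finset.univ) _
    have h3 : (#(agree q) : ℝ) + #(Finset.univ.filter fun y => ¬ (R q.1 y ↔ R q.2 y))
        = Fintype.card Y := by exact_mod_cast h2
    linarith
  have hcount : (Fintype.card Y : ℝ) ^ k ≤
      #G.offDiag * ((1 - η) * Fintype.card Y) ^ k := by
    have h1 := (Finset.card_le_card hcover).trans Finset.card_biUnion_le
    rw [Finset.card_univ, Fintype.card_fun, Fintype.card_fin] at h1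
    calc (Fintype.card Y : ℝ) ^ k
        ≤ ∑ q ∈ G.offDiag, (#(Fintype.piFinset fun _ : Fin k => agree q) : ℝ) := by
          exact_mod_cast h1
      _ ≤ ∑ q ∈ G.offDiag, ((1 - η) * Fintype.card Y) ^ k := by
          refine Finset.sum_le_sum fun q hq => ?_
          simp only [Fintype.card_piFinset, Finset.prod_const, Finset.card_univ,
            Fintype.card_fin, Nat.cast_pow]
          exact pow_le_pow_left₀ (by positivity) (hagree q hq) k
      _ = _ := by rw [Finset.sum_const, nsmul_eq_mul]
  have hM : (0 : ℝ) < #G := by exact_mod_cast hG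
  have hexp : (1 - η) ^ k ≤ ((#G : ℝ) ^ 2)⁻¹ := by
    calc (1 - η) ^ k ≤ Real.exp (-η) ^ k :=
          pow_le_pow_left₀ (by linarith) (Real.one_sub_le_exp_neg η) k
      _ = Real.exp (-(η * k)) := by rw [← Real.exp_nat_mul]; ring_nf
      _ ≤ Real.exp (-(2 * Real.log #G)) := Real.exp_le_exp.2 (by linarith)
      _ = _ := by
          rw [Real.exp_neg, two_mul, Real.exp_add, Real.exp_log hM, sq]
  have hoff : (#G.offDiag : ℝ) = (#G : ℝ) ^ 2 - #G := by
    rw [Finset.offDiag_card, Nat.cast_sub (Nat.le_mul_self _), Nat.cast_mul, sq]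
  rw [mul_pow, ← mul_assoc] at hcount
  have h1 : 1 ≤ (#G.offDiag : ℝ) * (1 - η) ^ k := by
    have := pow_pos hY k
    nlinarith
  have h2 : (#G.offDiag : ℝ) * (1 - η) ^ k ≤ #G.offDiag * ((#G : ℝ) ^ 2)⁻¹ := by gcongr
  have h3 : (#G.offDiag : ℝ) * ((#G : ℝ) ^ 2)⁻¹ < 1 := by
    rw [hoff, ← div_eq_mul_inv, div_lt_one (by positivity)]
    linarith
  linarith

lemma sum_choose_le {d k : ℕ} {x : ℝ} (hx : 0 < x) (hx1 : x ≤ 1) :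
    (∑ i ∈ Finset.Iic d, (k.choose i : ℝ)) ≤ (x⁻¹) ^ d * Real.exp (k * x) := by
  calc (∑ i ∈ Finset.Iic d, (k.choose i : ℝ))
      ≤ ∑ i ∈ Finset.Iic d, (x⁻¹) ^ d * (x ^ i * k.choose i) := by
        refine Finset.sum_le_sum fun i hi => ?_
        rw [← mul_assoc]
        refine le_mul_of_one_le_left (by positivity) ?_
        rw [inv_pow, inv_mul_eq_div, one_le_div (by positivity)]
        exact pow_le_pow_of_le_one hx.le hx1 (Finset.mem_Iic.1 hi)
    _ = (x⁻¹) ^ d * ∑ i ∈ Finset.Iic d, x ^ i * k.choose i := by rw [Finset.mul_sum]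
    _ ≤ (x⁻¹) ^ d * (x + 1) ^ k := by
        refine mul_le_mul_of_nonneg_left ?_ (by positivity)
        rw [add_pow]
        simp only [one_pow, mul_one]
        have hsub : ∑ i ∈ Finset.Iic d, x ^ i * (k.choose i : ℝ)
            ≤ ∑ i ∈ Finset.Iic d ∪ Finset.range (k + 1), x ^ i * (k.choose i : ℝ) :=
          Finset.sum_le_sum_of_subset_of_nonneg Finset.subset_union_left
            fun i _ _ => by positivity
        refine hsub.trans_eq ?_
        symm
        refine Finset.sum_subset Finset.subset_union_right fun i _ hi => ?_
        rw [Finset.mem_range, not_lt] at hi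
        rw [Nat.choose_eq_zero_of_lt (by omega)]
        simp
    _ ≤ (x⁻¹) ^ d * Real.exp (k * x) := by
        refine mul_le_mul_of_nonneg_left ?_ (by positivity)
        rw [Real.exp_nat_mul]
        exact pow_le_pow_left₀ (by positivity) (Real.add_one_le_exp x) k

/-- Packing bound for set systems of bounded VC dimension, in indexed form. -/
lemma card_le_of_pairwise_disagree {β Y : Type*} [Fintype Y] [Nonempty Y]
    (G : Finset β) (R : β → Y → Prop) [∀ a y, Decidable (R a y)] (d : ℕ)
    (hd : ∀ (k : ℕ) (κ : Fin k → Y),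
      (∀ S : Finset (Fin k), ∃ a ∈ G, ∀ j, j ∈ S ↔ R a (κ j)) → k ≤ d)
    (η : ℝ) (hη : 0 < η) (hη1 : η ≤ 1)
    (sep : ∀ a ∈ G, ∀ b ∈ G, a ≠ b →
      η * Fintype.card Y ≤ #(Finset.univ.filter fun y => ¬ (R a y ↔ R b y))) :
    (#G : ℝ) ≤ (8 / η) ^ (2 * d) := by
  classical
  have hbase : 1 ≤ 8 / η := by rw [one_le_div hη]; linarith
  rcases Nat.lt_or_ge 1 #G with hG | hG
  swap
  · calc (#G : ℝ) ≤ 1 := by exact_mod_cast hG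
      _ ≤ _ := one_le_pow₀ hbase
  have hM2 : (2 : ℝ) ≤ #G := by exact_mod_cast hG
  have hM : (0 : ℝ) < #G := by linarith
  have hlog : 1 / 2 ≤ Real.log #G := by
    have := Real.log_two_gt_d9
    have := Real.log_le_log (by norm_num) hM2
    linarith
  set k := ⌈2 * Real.log #G / η⌉₊ with hk
  have hk1 : 2 * Real.log #G ≤ η * k := by
    have := Nat.le_ceil (2 * Real.log #G / η)
    rw [div_le_iff₀ hη] at this
    linarith
  have hk2 : η * k ≤ 4 * Real.log #G := by
    have h := (Nat.ceil_lt_add_one (a := 2 * Real.log #G / η) (by positivity)).le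
    have h' := mul_le_mul_of_nonneg_left h hη.le
    rw [mul_add, mul_div_cancel₀ _ hη.ne'] at h'
    linarith
  obtain ⟨κ, hκ⟩ := exists_separating_points G R η hη1 sep (by omega) k hk1
  let pat : β → Finset (Fin k) := fun a => Finset.univ.filter fun l => R a (κ l)
  have hinj : Set.InjOn pat G := by
    intro a ha b hb hab
    refine hκ a ha b hb fun l => ?_
    have := congrArg (l ∈ ·) hab
    simpa [pat] using this
  have hvc : (G.image pat).vcDim ≤ d := by
    refine Finset.sup_le fun s hs => ?_
    rw [Finset.mem_shatterer] at hs
    refine hd #s (fun j => κ (s.orderEmbOfFin rfl j)) fun S => ?_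
    obtain ⟨u, hu, hu'⟩ := hs (t := S.map (s.orderEmbOfFin rfl).toEmbedding) (by
      intro x hx
      obtain ⟨j, _, rfl⟩ := Finset.mem_map.1 hx
      exact s.orderEmbOfFin_mem rfl j)
    obtain ⟨a, ha, rfl⟩ := Finset.mem_image.1 hu
    refine ⟨a, ha, fun j => ?_⟩
    have h := congrArg ((s.orderEmbOfFin rfl j) ∈ ·) hu'
    have hmem := s.orderEmbOfFin_mem rfl j
    simp only [Finset.mem_inter, hmem, true_and, pat, Finset.mem_filter, Finset.mem_univ,
      eq_iff_iff] at h
    rw [h, Finset.mem_map]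
    simp
  have hsauer : (#G : ℝ) ≤ ∑ i ∈ Finset.Iic d, (k.choose i : ℝ) := by
    have h1 : #G ≤ ∑ i ∈ Finset.Iic d, k.choose i := by
      rw [← Finset.card_image_of_injOn hinj]
      refine (Finset.card_le_card_shatterer _).trans
        (Finset.card_shatterer_le_sum_vcDim.trans ?_)
      rw [Fintype.card_fin]
      exact Finset.sum_le_sum_of_subset (Finset.Iic_subset_Iic.2 hvc)
    exact_mod_cast h1
  have hx := hsauer.trans (sum_choose_le (d := d) (k := k) (x := η / 8) (by positivity)
    (by linarith))
  have hexp : Real.exp (k * (η / 8)) ≤ √(#G : ℝ) := by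
    rw [Real.sqrt_eq_rpow, Real.rpow_def_of_pos hM]
    exact Real.exp_le_exp.2 (by linarith)
  have hs : 0 < √(#G : ℝ) := Real.sqrt_pos.2 hM
  have hss : √(#G : ℝ) * √(#G : ℝ) = #G := Real.mul_self_sqrt hM.le
  have h8 : √(#G : ℝ) ≤ (8 / η) ^ d := by
    have h := hx.trans (mul_le_mul_of_nonneg_left hexp (by positivity))
    rw [inv_div] at h
    nlinarith
  calc (#G : ℝ) = √(#G : ℝ) * √(#G : ℝ) := hss.symm
    _ ≤ (8 / η) ^ d * (8 / η) ^ d := mul_le_mul h8 h8 hs.le (by positivity)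
    _ = _ := by rw [two_mul, pow_add]

/-- A class of real functions pseudo-shatters some `k` points. -/
def PseudoShatters {X : Type*} (F : Set (X → ℝ)) (k : ℕ) : Prop :=
  ∃ x : Fin k → X, ∃ τ : Fin k → ℝ, ∀ S : Finset (Fin k), ∃ f ∈ F,
    (∀ j, j ∈ S → τ j ≤ f (x j)) ∧ (∀ j, j ∉ S → f (x j) < τ j)

lemma card_grid_filter {Q : ℕ} {a : ℝ} (ha : a ∈ Set.Icc (0 : ℝ) 1) :
    #(Finset.univ.filter fun q : Fin Q => (q : ℝ) + 1 ≤ Q * a) = ⌊(Q : ℝ) * a⌋₊ := by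
  have h0 : 0 ≤ (Q : ℝ) * a := mul_nonneg (by positivity) ha.1
  have h : ∀ q : Fin Q, ((q : ℝ) + 1 ≤ Q * a) ↔ (q : ℕ) < ⌊(Q : ℝ) * a⌋₊ := by
    intro q
    rw [← Nat.succ_le_iff, Nat.le_floor_iff h0]
    push_cast
    rfl
  simp only [h]
  rw [Fin.card_filter_val_lt, min_eq_right]
  refine Nat.floor_le_of_le ?_
  exact mul_le_of_le_one_right (by positivity) ha.2

/-- Two numbers in the unit interval are distinguished by a proportional number of grid
thresholds. -/
lemma le_card_grid_disagree {Q : ℕ} {a b : ℝ} (ha : a ∈ Set.Icc (0 : ℝ) 1)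
    (hb : b ∈ Set.Icc (0 : ℝ) 1) :
    Q * |a - b| - 1 ≤ #(Finset.univ.filter fun q : Fin Q =>
      ¬ ((q : ℝ) + 1 ≤ Q * a ↔ (q : ℝ) + 1 ≤ Q * b)) := by
  classical
  have key : ∀ {a b : ℝ}, a ∈ Set.Icc (0 : ℝ) 1 → b ∈ Set.Icc (0 : ℝ) 1 →
      Q * (a - b) - 1 ≤ #(Finset.univ.filter fun q : Fin Q =>
      ¬ ((q : ℝ) + 1 ≤ Q * a ↔ (q : ℝ) + 1 ≤ Q * b)) := by
    intro a b ha hb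
    have hsub : (Finset.univ.filter fun q : Fin Q => (q : ℝ) + 1 ≤ Q * a) ⊆
        (Finset.univ.filter fun q : Fin Q => (q : ℝ) + 1 ≤ Q * b) ∪
        (Finset.univ.filter fun q : Fin Q =>
          ¬ ((q : ℝ) + 1 ≤ Q * a ↔ (q : ℝ) + 1 ≤ Q * b)) := by
      intro q
      simp only [Finset.mem_union, Finset.mem_filter, Finset.mem_univ, true_and]
      tauto
    have h := (Finset.card_le_card hsub).trans (Finset.card_union_le _ _)
    rw [card_grid_filter ha, card_grid_filter hb] at h
    have h' : (⌊(Q : ℝ) * a⌋₊ : ℝ) ≤ ⌊(Q : ℝ) * b⌋₊ + #(Finset.univ.filter fun q : Fin Q =>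
          ¬ ((q : ℝ) + 1 ≤ Q * a ↔ (q : ℝ) + 1 ≤ Q * b)) := by exact_mod_cast h
    have h1 := Nat.lt_floor_add_one ((Q : ℝ) * a)
    have h2 := Nat.floor_le (mul_nonneg (Nat.cast_nonneg Q) hb.1)
    linarith
  rcases abs_cases (a - b) with h | h
  · rw [h.1]; exact key ha hb
  · rw [h.1, neg_sub]
    simpa only [iff_comm] using key hb ha

/-- Packing bound in `L¹` for classes of bounded pseudo-dimension. -/
lemma card_le_of_separated {I : Type*} [Fintype I] [Nonempty I] {V : Set (I → ℝ)}
    (hV : ∀ f ∈ V, ∀ i, f i ∈ Set.Icc (0 : ℝ) 1) {d : ℕ}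
    (hd : ∀ k, PseudoShatters V k → k ≤ d) {η : ℝ} (hη : 0 < η) (hη1 : η ≤ 1)
    (G : Finset (I → ℝ)) (hG : ↑G ⊆ V)
    (sep : ∀ a ∈ G, ∀ b ∈ G, a ≠ b → η * Fintype.card I ≤ ∑ i, |a i - b i|) :
    (#G : ℝ) ≤ (16 / η) ^ (2 * d) := by
  classical
  set Q := ⌈2 / η⌉₊
  have hQ : 2 / η ≤ Q := Nat.le_ceil _
  have hQ0 : (0 : ℝ) < Q := lt_of_lt_of_le (by positivity) hQ
  have hQη : 2 ≤ Q * η := by rwa [div_le_iff₀ hη] at hQ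
  have : NeZero Q := ⟨by exact_mod_cast hQ0.ne'⟩
  let R : (I → ℝ) → I × Fin Q → Prop := fun g y => (y.2 : ℝ) + 1 ≤ Q * g y.1
  have h := card_le_of_pairwise_disagree G R d ?_ (η / 2) (by positivity) (by linarith) ?_
  · rwa [show 8 / (η / 2) = 16 / η by field_simp; norm_num] at h
  · intro k κ hκ
    refine hd k ⟨fun j => (κ j).1, fun j => (((κ j).2 : ℝ) + 1) / Q, fun S => ?_⟩
    obtain ⟨a, ha, h⟩ := hκ S
    refine ⟨a, hG ha, fun j hj => ?_, fun j hj => ?_⟩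
    · rw [div_le_iff₀' hQ0]
      exact (h j).1 hj
    · rw [lt_div_iff₀' hQ0]
      exact not_le.1 fun h' => hj ((h j).2 h')
  · intro a ha b hb hab
    have hcard : #(Finset.univ.filter fun y => ¬ (R a y ↔ R b y)) =
        ∑ i, #(Finset.univ.filter fun q : Fin Q =>
          ¬ ((q : ℝ) + 1 ≤ Q * a i ↔ (q : ℝ) + 1 ≤ Q * b i)) := by
      simp only [Finset.card_filter, Fintype.sum_prod_type, R]
    rw [hcard, Fintype.card_prod, Fintype.card_fin]
    push_cast
    have h1 : ∑ i, (Q * |a i - b i| - 1) ≤ ∑ i, (#(Finset.univ.filter fun q : Fin Q =>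
          ¬ ((q : ℝ) + 1 ≤ Q * a i ↔ (q : ℝ) + 1 ≤ Q * b i)) : ℝ) :=
      Finset.sum_le_sum fun i _ => le_card_grid_disagree (hV a (hG ha) i) (hV b (hG hb) i)
    refine le_trans ?_ h1
    rw [Finset.sum_sub_distrib, ← Finset.mul_sum, Finset.sum_const, Finset.card_univ,
      nsmul_eq_mul, mul_one]
    have h2 := mul_le_mul_of_nonneg_left (sep a ha b hb hab) hQ0.le
    have hI : (0 : ℝ) < Fintype.card I := by exact_mod_cast Fintype.card_pos
    nlinarith

/-- Finite `L¹`-covers of polynomial size for classes of bounded pseudo-dimension. -/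
lemma exists_cover {I : Type*} [Fintype I] [Nonempty I] {V : Set (I → ℝ)}
    (hV : ∀ f ∈ V, ∀ i, f i ∈ Set.Icc (0 : ℝ) 1) {d : ℕ}
    (hd : ∀ k, PseudoShatters V k → k ≤ d) {η : ℝ} (hη : 0 < η) (hη1 : η ≤ 1) :
    ∃ T : Finset (I → ℝ), (∀ g ∈ T, ∀ i, g i ∈ Set.Icc (0 : ℝ) 1) ∧
      (#T : ℝ) ≤ (16 / η) ^ (2 * d) ∧
      ∀ f ∈ V, ∃ g ∈ T, ∑ i, |f i - g i| ≤ η * Fintype.card I := by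
  classical
  by_contra! hcon
  have hsep : ∀ n : ℕ, ∃ G : Finset (I → ℝ), ↑G ⊆ V ∧ #G = n ∧
      ∀ a ∈ G, ∀ b ∈ G, a ≠ b → η * Fintype.card I ≤ ∑ i, |a i - b i| := by
    intro n
    induction n with
    | zero => exact ⟨∅, by simp, by simp, by simp⟩
    | succ n ih =>
      obtain ⟨G, hG, hn, hs⟩ := ih
      obtain ⟨f, hf, hfG⟩ := hcon G (fun g hg => hV g (hG hg))
        (card_le_of_separated hV hd hη hη1 G hG hs)
      have hfn : f ∉ G := by
        intro hmem
        have := hfG f hmem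
        simp only [sub_self, abs_zero, Finset.sum_const_zero] at this
        have : 0 ≤ η * Fintype.card I := by positivity
        linarith
      refine ⟨insert f G, ?_, by rw [Finset.card_insert_of_notMem hfn, hn], ?_⟩
      · rw [Finset.coe_insert]
        exact Set.insert_subset hf hG
      · intro a ha b hb hab
        rcases Finset.mem_insert.1 ha with rfl | ha' <;>
          rcases Finset.mem_insert.1 hb with rfl | hb'
        · exact absurd rfl hab
        · exact (hfG b hb').le
        · simpa only [abs_sub_comm] using (hfG a ha').le
        · exact hs a ha' b hb' hab
  obtain ⟨n, hn⟩ := exists_nat_gt ((16 / η) ^ (2 * d))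
  obtain ⟨G, hG, hGn, hs⟩ := hsep n
  have := card_le_of_separated hV hd hη hη1 G hG hs
  rw [hGn] at this
  linarith

/-- The sign attached to a boolean. -/
def boolSign (b : Bool) : ℝ := if b then 1 else -1

lemma sum_exp_boolSign_le {ι : Type*} [Fintype ι] [DecidableEq ι] (a : ι → ℝ) (x : ℝ) :
    ∑ σ : ι → Bool, Real.exp (x * ∑ i, boolSign (σ i) * a i) ≤
      2 ^ Fintype.card ι * Real.exp (x ^ 2 * (∑ i, a i ^ 2) / 2) := by
  calc ∑ σ : ι → Bool, Real.exp (x * ∑ i, boolSign (σ i) * a i)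
      = ∑ σ : ι → Bool, ∏ i, Real.exp (x * (boolSign (σ i) * a i)) := by
        simp only [Finset.mul_sum, Real.exp_sum]
    _ = ∏ i, ∑ b : Bool, Real.exp (x * (boolSign b * a i)) := by
        rw [Finset.prod_univ_sum, Fintype.piFinset_univ]
    _ = ∏ i, (2 * Real.cosh (x * a i)) := by
        refine Finset.prod_congr rfl fun i _ => ?_
        simp only [Fintype.sum_bool, boolSign, if_true, Real.cosh_eq]
        simp
        ring
    _ ≤ ∏ i, (2 * Real.exp ((x * a i) ^ 2 / 2)) := by
        refine Finset.prod_le_prod (fun i _ => by have := Real.cosh_pos (x * a i); positivity)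
          fun i _ => ?_
        exact mul_le_mul_of_nonneg_left (Real.cosh_le_exp_half_sq _) (by norm_num)
    _ = _ := by
        rw [Finset.prod_mul_distrib, ← Real.exp_sum, Finset.prod_const, Finset.card_univ]
        have h : ∑ i, (x * a i) ^ 2 / 2 = x ^ 2 * (∑ i, a i ^ 2) / 2 := by
          rw [Finset.mul_sum, Finset.sum_div]
          exact Finset.sum_congr rfl fun i _ => by ring
        rw [h]

lemma card_lt_boolSign_sum_le {ι : Type*} [Fintype ι] [DecidableEq ι] (a : ι → ℝ) {v t : ℝ}
    (hv : ∑ i, a i ^ 2 ≤ v) (hv0 : 0 < v) (ht : 0 ≤ t) :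
    (#(Finset.univ.filter fun σ : ι → Bool => t < ∑ i, boolSign (σ i) * a i) : ℝ) ≤
      2 ^ Fintype.card ι * Real.exp (-(t ^ 2 / (2 * v))) := by
  set x := t / v
  have hx : 0 ≤ x := by positivity
  have h1 : (#(Finset.univ.filter fun σ : ι → Bool => t < ∑ i, boolSign (σ i) * a i) : ℝ)
      * Real.exp (x * t) ≤ 2 ^ Fintype.card ι * Real.exp (x ^ 2 * v / 2) := by
    calc _ = ∑ σ : ι → Bool with t < ∑ i, boolSign (σ i) * a i, Real.exp (x * t) := by
          rw [Finset.sum_const, nsmul_eq_mul]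
      _ ≤ ∑ σ : ι → Bool with t < ∑ i, boolSign (σ i) * a i,
            Real.exp (x * ∑ i, boolSign (σ i) * a i) := by
          refine Finset.sum_le_sum fun σ hσ => Real.exp_le_exp.2 ?_
          exact mul_le_mul_of_nonneg_left (Finset.mem_filter.1 hσ).2.le hx
      _ ≤ ∑ σ : ι → Bool, Real.exp (x * ∑ i, boolSign (σ i) * a i) :=
          Finset.sum_le_sum_of_subset_of_nonneg (Finset.filter_subset _ _)
            fun _ _ _ => (Real.exp_pos _).le
      _ ≤ _ := sum_exp_boolSign_le a x
      _ ≤ _ := by gcongr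
  rw [← le_div_iff₀ (Real.exp_pos _), mul_div_assoc, ← Real.exp_sub] at h1
  refine h1.trans_eq ?_
  congr 2
  simp only [x]
  field_simp
  ring

/-- Hoeffding's inequality for Rademacher sums, in counting form. -/
lemma card_lt_abs_boolSign_sum_le {ι : Type*} [Fintype ι] [DecidableEq ι] (a : ι → ℝ) {v t : ℝ}
    (hv : ∑ i, a i ^ 2 ≤ v) (hv0 : 0 < v) (ht : 0 ≤ t) :
    (#(Finset.univ.filter fun σ : ι → Bool => t < |∑ i, boolSign (σ i) * a i|) : ℝ) ≤
      2 * (2 ^ Fintype.card ι * Real.exp (-(t ^ 2 / (2 * v)))) := by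
  have hsub : (Finset.univ.filter fun σ : ι → Bool => t < |∑ i, boolSign (σ i) * a i|) ⊆
      (Finset.univ.filter fun σ : ι → Bool => t < ∑ i, boolSign (σ i) * a i) ∪
      (Finset.univ.filter fun σ : ι → Bool => t < ∑ i, boolSign (σ i) * (- a) i) := by
    intro σ
    simp only [Finset.mem_union, Finset.mem_filter, Finset.mem_univ, true_and, Pi.neg_apply,
      mul_neg, Finset.sum_neg_distrib, lt_abs, imp_self]
  have h := (Finset.card_le_card hsub).trans (Finset.card_union_le _ _)
  have h' : (#(Finset.univ.filter fun σ : ι → Bool => t < |∑ i, boolSign (σ i) * a i|) : ℝ) ≤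
      #(Finset.univ.filter fun σ : ι → Bool => t < ∑ i, boolSign (σ i) * a i) +
      #(Finset.univ.filter fun σ : ι → Bool => t < ∑ i, boolSign (σ i) * (- a) i) := by
    exact_mod_cast h
  have h1 := card_lt_boolSign_sum_le a hv hv0 ht
  have h2 := card_lt_boolSign_sum_le (-a) (v := v) (by simpa using hv) hv0 ht
  linarith

/-- The signed sum of the differences between the two halves of a double sample. -/
def swapSum {N : ℕ} (σ : Fin N → Bool) (f : Fin N × Bool → ℝ) : ℝ :=
  ∑ i, boolSign (σ i) * (f (i, true) - f (i, false))

lemma swapSum_sub {N : ℕ} (σ : Fin N → Bool) (f g : Fin N × Bool → ℝ) :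
    swapSum σ (f - g) = swapSum σ f - swapSum σ g := by
  simp only [swapSum, ← Finset.sum_sub_distrib, Pi.sub_apply]
  exact Finset.sum_congr rfl fun i _ => by ring

lemma abs_swapSum_le {N : ℕ} (σ : Fin N → Bool) (f : Fin N × Bool → ℝ) :
    |swapSum σ f| ≤ ∑ y, |f y| := by
  rw [Fintype.sum_prod_type]
  refine (Finset.abs_sum_le_sum_abs _ _).trans (Finset.sum_le_sum fun i _ => ?_)
  have : |boolSign (σ i)| = 1 := by
    unfold boolSign; split_ifs <;> simp
  rw [abs_mul, this, one_mul, Fintype.sum_bool]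
  exact abs_sub _ _

/-- Tail bound for a single chaining link. -/
lemma card_lt_abs_swapSum_le {N : ℕ} (u : Fin N × Bool → ℝ) (hu : ∀ y, |u y| ≤ 1) {w t : ℝ}
    (hw : ∑ y, |u y| ≤ w) (hw0 : 0 < w) (ht : 0 ≤ t) :
    (#(Finset.univ.filter fun σ : Fin N → Bool => t < |swapSum σ u|) : ℝ) ≤
      2 * (2 ^ N * Real.exp (-(t ^ 2 / (4 * w)))) := by
  have h := card_lt_abs_boolSign_sum_le (fun i => u (i, true) - u (i, false))
    (v := 2 * w) (t := t) ?_ (by linarith) ht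
  · rw [Fintype.card_fin, show 2 * (2 * w) = 4 * w by ring] at h
    exact h
  · rw [Fintype.sum_prod_type] at hw
    refine le_trans ?_ (mul_le_mul_of_nonneg_left hw (by norm_num))
    rw [Finset.mul_sum]
    refine Finset.sum_le_sum fun i _ => ?_
    rw [Fintype.sum_bool]
    have h1 := hu (i, true)
    have h2 := hu (i, false)
    have h3 : u (i, true) ^ 2 ≤ |u (i, true)| := by
      rw [← sq_abs]; nlinarith [abs_nonneg (u (i, true))]
    have h4 : u (i, false) ^ 2 ≤ |u (i, false)| := by
      rw [← sq_abs]; nlinarith [abs_nonneg (u (i, false))]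
    nlinarith [sq_nonneg (u (i, true) + u (i, false))]

/-- The total weight of the links at one scale of the chaining argument. -/
lemma link_weight_le {N d j : ℕ} (hd : 1 ≤ d) {ε l : ℝ} (hl : 0 ≤ l)
    (hNε : 4096 * (27 * d + l) ≤ N * ε ^ 2) :
    ((4 : ℝ) ^ (j + 3)) ^ (4 * d) * (2 * (2 ^ N * Real.exp (-(N * ε ^ 2 / 4096 * (9 / 4) ^ j)))) ≤
      2 ^ N * Real.exp (-l) * (2 * (1 / 8) ^ (j + 1)) := by
  have hd' : (1 : ℝ) ≤ d := by exact_mod_cast hd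
  have he : (2 : ℝ) ≤ Real.exp 1 := by have := Real.exp_one_gt_d9; linarith
  have h4 : (4 : ℝ) ≤ Real.exp 2 := by
    rw [show (2 : ℝ) = 1 + 1 by norm_num, Real.exp_add]; nlinarith
  have h8 : Real.exp (-3) ≤ 1 / 8 := by
    rw [Real.exp_neg, one_div]
    refine inv_anti₀ (by norm_num) ?_
    rw [show (3 : ℝ) = 2 + 1 by norm_num, Real.exp_add]; nlinarith
  have hb : (j : ℝ) + 1 ≤ (9 / 4) ^ j := by
    have := one_add_mul_le_pow (a := (5 / 4 : ℝ)) (by norm_num) j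
    norm_num at this
    have hj : (0 : ℝ) ≤ j := by positivity
    linarith
  have hcard : ((4 : ℝ) ^ (j + 3)) ^ (4 * d) ≤ Real.exp (24 * d * (j + 1)) := by
    calc ((4 : ℝ) ^ (j + 3)) ^ (4 * d) ≤ (Real.exp 2 ^ (j + 3)) ^ (4 * d) := by gcongr
      _ = Real.exp (8 * d * (j + 3)) := by
          rw [← Real.exp_nat_mul, ← Real.exp_nat_mul]; push_cast; ring_nf
      _ ≤ _ := by
          refine Real.exp_le_exp.2 ?_
          have : (0 : ℝ) ≤ d * j := by positivity
          nlinarith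
  have hq : Real.exp (-3) ^ (j + 1) ≤ (1 / 8) ^ (j + 1) :=
    pow_le_pow_left₀ (Real.exp_pos _).le h8 _
  have hexp : Real.exp (24 * d * (j + 1)) * Real.exp (-(N * ε ^ 2 / 4096 * (9 / 4) ^ j)) ≤
      Real.exp (-l) * Real.exp (-3) ^ (j + 1) := by
    rw [← Real.exp_nat_mul, ← Real.exp_add, ← Real.exp_add]
    refine Real.exp_le_exp.2 ?_
    push_cast
    have h1 : 27 * d + l ≤ N * ε ^ 2 / 4096 := by linarith
    have h2 : (27 * d + l) * ((j : ℝ) + 1) ≤ N * ε ^ 2 / 4096 * (9 / 4) ^ j :=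
      mul_le_mul h1 hb (by positivity) (by positivity)
    have hj : (0 : ℝ) ≤ j := by positivity
    nlinarith [mul_nonneg hl hj, mul_nonneg (sub_nonneg.2 hd') hj]
  calc _ ≤ Real.exp (24 * d * (j + 1)) *
        (2 * (2 ^ N * Real.exp (-(N * ε ^ 2 / 4096 * (9 / 4) ^ j)))) := by gcongr
    _ = 2 * 2 ^ N * (Real.exp (24 * d * (j + 1)) *
        Real.exp (-(N * ε ^ 2 / 4096 * (9 / 4) ^ j))) := by ring
    _ ≤ 2 * 2 ^ N * (Real.exp (-l) * (1 / 8) ^ (j + 1)) := by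
        refine mul_le_mul_of_nonneg_left (hexp.trans ?_) (by positivity)
        exact mul_le_mul_of_nonneg_left hq (Real.exp_pos _).le
    _ = _ := by ring

/-- Chaining: uniformly over a class of pseudo-dimension at most `d`, few sign vectors give a
large swap sum. -/
lemma card_exists_lt_abs_swapSum_le {N : ℕ} (hN : 0 < N) {V : Set (Fin N × Bool → ℝ)}
    (hV : ∀ f ∈ V, ∀ y, f y ∈ Set.Icc (0 : ℝ) 1) {d : ℕ} (hd1 : 1 ≤ d)
    (hd : ∀ k, PseudoShatters V k → k ≤ d) {ε l : ℝ} (hε : 0 < ε) (hl : 0 ≤ l)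
    (hNε : 4096 * (27 * d + l) ≤ N * ε ^ 2)
    (B : Finset (Fin N → Bool)) (hB : ∀ σ ∈ B, ∃ f ∈ V, N * ε / 2 < |swapSum σ f|) :
    (#B : ℝ) ≤ 2 ^ N * (Real.exp (-l) / 2) := by
  classical
  have hN' : (0 : ℝ) < N := by exact_mod_cast hN
  have : Nonempty (Fin N × Bool) := ⟨(⟨0, hN⟩, true)⟩
  have hcardI : (Fintype.card (Fin N × Bool) : ℝ) = 2 * N := by
    simp [mul_comm]
  have hT : ∀ j : ℕ, ∃ T : Finset (Fin N × Bool → ℝ),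
      (∀ g ∈ T, ∀ i, g i ∈ Set.Icc (0 : ℝ) 1) ∧
      (#T : ℝ) ≤ (4 ^ (j + 2)) ^ (2 * d) ∧
      (∀ f ∈ V, ∃ g ∈ T, ∑ i, |f i - g i| ≤ (1 / 4) ^ j * (2 * N)) ∧
      (j = 0 → ∀ g ∈ T, g = 0) := by
    intro j
    rcases Nat.eq_zero_or_pos j with rfl | hj
    · refine ⟨{0}, by simp, ?_, fun f hf => ⟨0, by simp, ?_⟩, by simp⟩
      · simpa using one_le_pow₀ (by norm_num)
      · rw [pow_zero, one_mul, ← hcardI, ← nsmul_one]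
        refine (Finset.sum_le_card_nsmul _ _ _ fun i _ => ?_)
        have := hV f hf i
        rw [Pi.zero_apply, sub_zero, abs_of_nonneg this.1]
        exact this.2
    · obtain ⟨T, h1, h2, h3⟩ := exists_cover hV hd (η := (1 / 4) ^ j) (by positivity)
        (pow_le_one₀ (by norm_num) (by norm_num))
      rw [hcardI] at h3
      refine ⟨T, h1, h2.trans_eq ?_, h3, fun h => absurd h hj.ne'⟩
      rw [one_div, inv_pow, div_inv_eq_mul, pow_add, mul_comm]
      norm_num
  choose T hT01 hTcard hTcov hT0 using hT
  obtain ⟨J, hJ⟩ := exists_pow_lt_of_lt_one (show 0 < ε / 8 by positivity)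
    (show (1 / 4 : ℝ) < 1 by norm_num)
  let links : ℕ → Finset ((Fin N × Bool → ℝ) × (Fin N × Bool → ℝ)) := fun j =>
    (T (j + 1) ×ˢ T j).filter fun q => ∑ i, |q.1 i - q.2 i| ≤ 4 * N * (1 / 4) ^ j
  let t : ℕ → ℝ := fun j => N * ε / 16 * (3 / 4) ^ j
  let bad : ℕ → Finset (Fin N → Bool) := fun j =>
    (links j).biUnion fun q => Finset.univ.filter fun σ => t j < |swapSum σ (q.1 - q.2)|
  have hBsub : B ⊆ (Finset.range J).biUnion bad := by
    intro σ hσ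
    obtain ⟨f, hf, hlarge⟩ := hB σ hσ
    by_contra hgood
    choose π hπ hπd using fun j => hTcov j f hf
    have hlink : ∀ j ∈ Finset.range J,
        |swapSum σ (π (j + 1)) - swapSum σ (π j)| ≤ t j := by
      intro j hj
      by_contra hlt
      rw [not_le, ← swapSum_sub] at hlt
      refine hgood (Finset.mem_biUnion.2 ⟨j, hj, Finset.mem_biUnion.2
        ⟨(π (j + 1), π j), Finset.mem_filter.2 ⟨Finset.mem_product.2 ⟨hπ _, hπ _⟩, ?_⟩,
          Finset.mem_filter.2 ⟨Finset.mem_univ _, hlt⟩⟩⟩)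
      calc ∑ i, |π (j + 1) i - π j i|
          ≤ ∑ i, (|f i - π (j + 1) i| + |f i - π j i|) := by
            refine Finset.sum_le_sum fun i _ => ?_
            rw [abs_sub_comm (f i) (π (j + 1) i)]
            exact abs_sub_le _ _ _
        _ ≤ (1 / 4) ^ (j + 1) * (2 * N) + (1 / 4) ^ j * (2 * N) := by
            rw [Finset.sum_add_distrib]
            exact add_le_add (hπd _) (hπd _)
        _ ≤ _ := by
            have : (0 : ℝ) < (1 / 4) ^ j * N := by positivity
            rw [pow_succ]
            linarith
    have hπ0 : swapSum σ (π 0) = 0 := by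
      rw [hT0 0 rfl _ (hπ 0)]; simp [swapSum]
    have htel : |swapSum σ (π J)| ≤ N * ε / 4 := by
      have h1 := Finset.sum_range_sub (fun j => swapSum σ (π j)) J
      rw [hπ0, sub_zero] at h1
      rw [← h1]
      refine (Finset.abs_sum_le_sum_abs _ _).trans ((Finset.sum_le_sum hlink).trans ?_)
      rw [← Finset.mul_sum, geom_sum_eq (by norm_num)]
      have : (0 : ℝ) < (3 / 4) ^ J := by positivity
      have h2 : ((3 / 4 : ℝ) ^ J - 1) / (3 / 4 - 1) ≤ 4 := by
        rw [div_le_iff_of_neg (by norm_num)]; linarith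
      calc N * ε / 16 * (((3 / 4 : ℝ) ^ J - 1) / (3 / 4 - 1)) ≤ N * ε / 16 * 4 := by gcongr
        _ = _ := by ring
    have hres : |swapSum σ f - swapSum σ (π J)| ≤ N * ε / 4 := by
      rw [← swapSum_sub]
      refine (abs_swapSum_le _ _).trans ((hπd J).trans ?_)
      nlinarith
    have := abs_sub_abs_le_abs_sub (swapSum σ f) (swapSum σ (π J))
    linarith
  have hbad : ∀ j, (#(bad j) : ℝ) ≤ 2 ^ N * Real.exp (-l) * (2 * (1 / 8) ^ (j + 1)) := by
    intro j
    have hlinks : (#(links j) : ℝ) ≤ ((4 : ℝ) ^ (j + 3)) ^ (4 * d) := by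
      have h1 : #(links j) ≤ #(T (j + 1)) * #(T j) :=
        (Finset.card_filter_le _ _).trans_eq (Finset.card_product _ _)
      calc (#(links j) : ℝ) ≤ #(T (j + 1)) * #(T j) := by exact_mod_cast h1
        _ ≤ (4 ^ (j + 3)) ^ (2 * d) * (4 ^ (j + 2)) ^ (2 * d) := by
            gcongr
            · exact hTcard (j + 1)
            · exact hTcard j
        _ ≤ (4 ^ (j + 3)) ^ (2 * d) * (4 ^ (j + 3)) ^ (2 * d) := by
            gcongr <;> norm_num
        _ = _ := by rw [← pow_add]; congr 1; ring
    refine le_trans ?_ (link_weight_le hd1 hl hNε)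
    calc (#(bad j) : ℝ)
        ≤ ∑ q ∈ links j,
          (#(Finset.univ.filter fun σ => t j < |swapSum σ (q.1 - q.2)|) : ℝ) := by
          exact_mod_cast Finset.card_biUnion_le
      _ ≤ ∑ q ∈ links j, 2 * (2 ^ N * Real.exp (-(N * ε ^ 2 / 4096 * (9 / 4) ^ j))) := by
          refine Finset.sum_le_sum fun q hq => ?_
          obtain ⟨hqT, hqd⟩ := Finset.mem_filter.1 hq
          obtain ⟨hq1, hq2⟩ := Finset.mem_product.1 hqT
          refine (card_lt_abs_swapSum_le (q.1 - q.2) (fun y => ?_) hqd (by positivity)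
            (by positivity)).trans_eq ?_
          · have h1 := hT01 _ _ hq1 y
            have h2 := hT01 _ _ hq2 y
            rw [Pi.sub_apply, abs_le]
            constructor <;> linarith [h1.1, h1.2, h2.1, h2.2]
          · congr 4
            have h94 : ((9 : ℝ) / 4) ^ j = ((3 / 4) ^ j) ^ 2 / (1 / 4) ^ j := by
              rw [← pow_mul, mul_comm j 2, pow_mul, ← div_pow]; norm_num
            rw [h94]
            simp only [t]
            field_simp
            norm_num
      _ = #(links j) * (2 * (2 ^ N * Real.exp (-(N * ε ^ 2 / 4096 * (9 / 4) ^ j)))) := by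
          rw [Finset.sum_const, nsmul_eq_mul]
      _ ≤ _ := by gcongr
  calc (#B : ℝ) ≤ ∑ j ∈ Finset.range J, (#(bad j) : ℝ) := by
        exact_mod_cast (Finset.card_le_card hBsub).trans Finset.card_biUnion_le
    _ ≤ ∑ j ∈ Finset.range J, 2 ^ N * Real.exp (-l) * (2 * (1 / 8) ^ (j + 1)) :=
        Finset.sum_le_sum fun j _ => hbad j
    _ = 2 ^ N * Real.exp (-l) * (1 / 4 * ∑ j ∈ Finset.range J, (1 / 8) ^ j) := by
        rw [← Finset.mul_sum, Finset.mul_sum (s := Finset.range J) (a := 1 / 4)]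
        congr 1
        exact Finset.sum_congr rfl fun j _ => by rw [pow_succ]; ring
    _ ≤ 2 ^ N * Real.exp (-l) * (1 / 2) := by
        refine mul_le_mul_of_nonneg_left ?_ (by positivity)
        rw [geom_sum_eq (by norm_num)]
        have : (0 : ℝ) < (1 / 8) ^ J := by positivity
        have h2 : ((1 / 8 : ℝ) ^ J - 1) / (1 / 8 - 1) ≤ 2 := by
          rw [div_le_iff_of_neg (by norm_num)]; linarith
        linarith
    _ = _ := by ring

/-- Exchange, according to a sign vector, the entries of two samples. -/
def swapSamples {X : Type*} {N : ℕ} (σ : Fin N → Bool) (z : (Fin N → X) × (Fin N → X)) :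
    (Fin N → X) × (Fin N → X) :=
  (fun i => if σ i then z.1 i else z.2 i, fun i => if σ i then z.2 i else z.1 i)

lemma swapSamples_involutive {X : Type*} {N : ℕ} (σ : Fin N → Bool) :
    Function.Involutive (swapSamples (X := X) σ) := by
  rintro ⟨s, s'⟩
  simp only [swapSamples, Prod.mk.injEq]
  constructor <;> funext i <;> cases σ i <;> simp

section FiniteSampling

variable {X : Type*} [Fintype X] {p : X → ℝ}

lemma sum_prod_weights (hp1 : ∑ x, p x = 1) (N : ℕ) :
    ∑ s : Fin N → X, ∏ i, p (s i) = 1 := by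
  classical
  have h := Finset.prod_univ_sum (fun _ : Fin N => (Finset.univ : Finset X)) fun _ x => p x
  rw [Fintype.piFinset_univ] at h
  rw [← h]
  simp [hp1]

lemma sum_prod_weights_mul_mul (g : X → ℝ) (hg : ∑ x, p x * g x = 0) {N : ℕ}
    {i j : Fin N} (hij : i ≠ j) :
    ∑ s : Fin N → X, (∏ k, p (s k)) * (g (s i) * g (s j)) = 0 := by
  classical
  let h : Fin N → X → ℝ := fun k x =>
    p x * ((if k = i then g x else 1) * (if k = j then g x else 1))
  have hprod : ∀ s : Fin N → X, (∏ k, p (s k)) * (g (s i) * g (s j)) = ∏ k, h k (s k) := by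
    intro s
    simp only [h, Finset.prod_mul_distrib, Finset.prod_ite_eq', Finset.mem_univ, if_true]
  have hsum := Finset.prod_univ_sum (fun _ : Fin N => (Finset.univ : Finset X)) h
  rw [Fintype.piFinset_univ] at hsum
  simp only [hprod]
  rw [← hsum]
  refine Finset.prod_eq_zero (Finset.mem_univ i) ?_
  simpa [h, hij] using hg

lemma sum_prod_weights_mul_sq_le (hp : ∀ x, 0 ≤ p x) (hp1 : ∑ x, p x = 1) (g : X → ℝ)
    (hg : ∑ x, p x * g x = 0) (hg1 : ∀ x, |g x| ≤ 1) (N : ℕ) :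
    ∑ s : Fin N → X, (∏ k, p (s k)) * (∑ i, g (s i)) ^ 2 ≤ N := by
  classical
  have hswap : ∑ s : Fin N → X, (∏ k, p (s k)) * (∑ i, g (s i)) ^ 2 =
      ∑ i : Fin N, ∑ j : Fin N, ∑ s : Fin N → X, (∏ k, p (s k)) * (g (s i) * g (s j)) := by
    simp_rw [sq, Finset.sum_mul_sum, Finset.mul_sum]
    rw [Finset.sum_comm]
    exact Finset.sum_congr rfl fun i _ => Finset.sum_comm
  rw [hswap]
  calc _ ≤ ∑ i : Fin N, (1 : ℝ) := by
        refine Finset.sum_le_sum fun i _ => ?_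
        rw [Finset.sum_eq_single i (fun j _ hj => sum_prod_weights_mul_mul g hg hj.symm)
          (by simp), ← sum_prod_weights hp1 N]
        refine Finset.sum_le_sum fun s _ => ?_
        refine mul_le_of_le_one_right (Finset.prod_nonneg fun k _ => hp _) ?_
        have := hg1 (s i)
        rw [← abs_mul_abs_self]
        exact mul_le_one₀ this (abs_nonneg _) this
    _ = N := by simp

/-- Chebyshev's inequality for the sample average of a single function. -/
lemma half_le_sum_concentrated (hp : ∀ x, 0 ≤ p x) (hp1 : ∑ x, p x = 1) (g : X → ℝ)
    (hg : ∑ x, p x * g x = 0) (hg1 : ∀ x, |g x| ≤ 1) {N : ℕ} (hN : 0 < N) {ε : ℝ} (hε : 0 < ε)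
    (hNε : 8 ≤ N * ε ^ 2) :
    1 / 2 ≤ ∑ s : Fin N → X with |∑ i, g (s i)| ≤ N * ε / 2, ∏ i, p (s i) := by
  classical
  have hN' : (0 : ℝ) < N := by exact_mod_cast hN
  have hnn : ∀ s : Fin N → X, 0 ≤ ∏ i, p (s i) := fun s => Finset.prod_nonneg fun k _ => hp _
  have hsplit := Finset.sum_filter_add_sum_filter_not (Finset.univ : Finset (Fin N → X))
    (fun s => |∑ i, g (s i)| ≤ N * ε / 2) (fun s => ∏ i, p (s i))
  rw [sum_prod_weights hp1] at hsplit
  have htail : (∑ s : Fin N → X with ¬ |∑ i, g (s i)| ≤ N * ε / 2, ∏ i, p (s i))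
      * (N * ε / 2) ^ 2 ≤ N := by
    refine le_trans ?_ (sum_prod_weights_mul_sq_le hp hp1 g hg hg1 N)
    rw [Finset.sum_mul]
    calc _ ≤ ∑ s : Fin N → X with ¬ |∑ i, g (s i)| ≤ N * ε / 2,
          (∏ k, p (s k)) * (∑ i, g (s i)) ^ 2 := by
          refine Finset.sum_le_sum fun s hs => mul_le_mul_of_nonneg_left ?_ (hnn s)
          rw [← sq_abs (∑ i, g (s i))]
          exact pow_le_pow_left₀ (by positivity) (not_le.1 (Finset.mem_filter.1 hs).2).le 2
      _ ≤ _ := Finset.sum_le_sum_of_subset_of_nonneg (Finset.filter_subset _ _)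
          fun s _ _ => mul_nonneg (hnn s) (sq_nonneg _)
  set q := ∑ s : Fin N → X with ¬ |∑ i, g (s i)| ≤ N * ε / 2, ∏ i, p (s i)
  have hq0 : 0 ≤ q := Finset.sum_nonneg fun s _ => hnn s
  have hq : q ≤ 1 / 2 := by
    by_contra! hlt
    have h1 : 2 * (N : ℝ) ≤ (N * ε / 2) ^ 2 := by nlinarith
    nlinarith
  linarith

lemma sum_weights_swapSamples (p : X → ℝ) {N : ℕ} (σ : Fin N → Bool)
    (h : (Fin N → X) × (Fin N → X) → ℝ) :
    ∑ z : (Fin N → X) × (Fin N → X), ((∏ i, p (z.1 i)) * ∏ i, p (z.2 i)) * h z =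
      ∑ z : (Fin N → X) × (Fin N → X),
        ((∏ i, p (z.1 i)) * ∏ i, p (z.2 i)) * h (swapSamples σ z) := by
  rw [← Equiv.sum_comp (swapSamples_involutive (X := X) σ).toPerm]
  refine Finset.sum_congr rfl fun z _ => ?_
  rw [Function.Involutive.coe_toPerm]
  congr 1
  rw [← Finset.prod_mul_distrib, ← Finset.prod_mul_distrib]
  refine Finset.prod_congr rfl fun i _ => ?_
  cases h : σ i <;> simp [swapSamples, h, mul_comm]

/-- Swap-symmetrised bound on the probability that two independent samples disagree. -/
lemma sum_exists_disagree_le (hp : ∀ x, 0 ≤ p x) (hp1 : ∑ x, p x = 1) {F : Set (X → ℝ)}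
    (hF : ∀ f ∈ F, ∀ x, f x ∈ Set.Icc (0 : ℝ) 1) {d : ℕ} (hd1 : 1 ≤ d)
    (hd : ∀ k, PseudoShatters F k → k ≤ d) {N : ℕ} (hN : 0 < N) {ε l : ℝ} (hε : 0 < ε)
    (hl : 0 ≤ l) (hNε : 4096 * (27 * d + l) ≤ N * ε ^ 2)
    (E : (Fin N → X) × (Fin N → X) → Prop) [DecidablePred E]
    (hE : ∀ z, E z → ∃ f ∈ F, N * ε / 2 < |∑ i, (f (z.1 i) - f (z.2 i))|) :
    ∑ z : (Fin N → X) × (Fin N → X),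
      ((∏ i, p (z.1 i)) * ∏ i, p (z.2 i)) * (if E z then 1 else 0) ≤ Real.exp (-l) / 2 := by
  classical
  have hnn : ∀ s : Fin N → X, 0 ≤ ∏ i, p (s i) := fun s => Finset.prod_nonneg fun k _ => hp _
  have hpoint : ∀ z : (Fin N → X) × (Fin N → X),
      ∑ σ : Fin N → Bool, (if E (swapSamples σ z) then (1 : ℝ) else 0) ≤
        2 ^ N * (Real.exp (-l) / 2) := by
    intro z
    rw [← Finset.sum_filter, Finset.sum_const, nsmul_one]
    let y : Fin N × Bool → X := fun q => if q.2 then z.1 q.1 else z.2 q.1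
    refine card_exists_lt_abs_swapSum_le hN (V := (fun f => f ∘ y) '' F) ?_ hd1 ?_ hε hl hNε _ ?_
    · rintro _ ⟨f, hf, rfl⟩ q
      exact hF f hf _
    · rintro k ⟨x, τ, h⟩
      refine hd k ⟨fun j => y (x j), τ, fun S => ?_⟩
      obtain ⟨_, ⟨f, hf, rfl⟩, hS⟩ := h S
      exact ⟨f, hf, hS⟩
    · intro σ hσ
      obtain ⟨f, hf, hlt⟩ := hE _ (Finset.mem_filter.1 hσ).2
      refine ⟨_, ⟨f, hf, rfl⟩, ?_⟩
      convert hlt using 2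
      refine Finset.sum_congr rfl fun i _ => ?_
      cases h : σ i <;> simp [boolSign, swapSamples, y, h]
  have havg : (2 : ℝ) ^ N * ∑ z : (Fin N → X) × (Fin N → X),
      ((∏ i, p (z.1 i)) * ∏ i, p (z.2 i)) * (if E z then 1 else 0) ≤
      2 ^ N * (Real.exp (-l) / 2) := by
    calc (2 : ℝ) ^ N * ∑ z : (Fin N → X) × (Fin N → X),
          ((∏ i, p (z.1 i)) * ∏ i, p (z.2 i)) * (if E z then 1 else 0)
        = ∑ σ : Fin N → Bool, ∑ z : (Fin N → X) × (Fin N → X),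
          ((∏ i, p (z.1 i)) * ∏ i, p (z.2 i)) * (if E (swapSamples σ z) then 1 else 0) := by
          simp only [← sum_weights_swapSamples p _ fun z => if E z then (1 : ℝ) else 0]
          rw [Finset.sum_const, Finset.card_univ, nsmul_eq_mul]
          simp
      _ = ∑ z : (Fin N → X) × (Fin N → X), ((∏ i, p (z.1 i)) * ∏ i, p (z.2 i)) *
          ∑ σ : Fin N → Bool, (if E (swapSamples σ z) then (1 : ℝ) else 0) := by
          rw [Finset.sum_comm]
          simp only [Finset.mul_sum]
      _ ≤ ∑ z : (Fin N → X) × (Fin N → X), ((∏ i, p (z.1 i)) * ∏ i, p (z.2 i)) *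
          (2 ^ N * (Real.exp (-l) / 2)) :=
          Finset.sum_le_sum fun z _ =>
            mul_le_mul_of_nonneg_left (hpoint z) (mul_nonneg (hnn _) (hnn _))
      _ = _ := by
          rw [← Finset.sum_mul, Fintype.sum_prod_type]
          simp only [← Finset.mul_sum, sum_prod_weights hp1, mul_one, one_mul]
  exact le_of_mul_le_mul_left havg (by positivity)

/-- Uniform convergence over a class of pseudo-dimension at most `d`, at the optimal rate. -/
theorem sum_exists_deviation_le (hp : ∀ x, 0 ≤ p x) (hp1 : ∑ x, p x = 1) {F : Set (X → ℝ)}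
    (hF : ∀ f ∈ F, ∀ x, f x ∈ Set.Icc (0 : ℝ) 1) {d : ℕ} (hd1 : 1 ≤ d)
    (hd : ∀ k, PseudoShatters F k → k ≤ d) {N : ℕ} (hN : 0 < N) {ε l : ℝ} (hε : 0 < ε)
    (hl : 0 ≤ l) (hNε : 4096 * (27 * d + l) ≤ N * ε ^ 2)
    (B : Finset (Fin N → X))
    (hB : ∀ s ∈ B, ∃ f ∈ F, N * ε < |∑ i, (f (s i) - ∑ x, p x * f x)|) :
    ∑ s ∈ B, ∏ i, p (s i) ≤ Real.exp (-l) := by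
  classical
  have hnn : ∀ s : Fin N → X, 0 ≤ ∏ i, p (s i) := fun s => Finset.prod_nonneg fun k _ => hp _
  let E : (Fin N → X) × (Fin N → X) → Prop := fun z =>
    ∃ f ∈ F, N * ε / 2 < |∑ i, (f (z.1 i) - f (z.2 i))|
  have h8 : 8 ≤ N * ε ^ 2 := by
    have : (1 : ℝ) ≤ d := by exact_mod_cast hd1
    linarith
  have hghost : ∀ s ∈ B, 1 / 2 ≤ ∑ s' : Fin N → X,
      (∏ i, p (s' i)) * (if E (s, s') then 1 else 0) := by
    intro s hs
    obtain ⟨f, hf, hdev⟩ := hB s hs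
    set μ := ∑ x, p x * f x
    have hμ0 : 0 ≤ μ := Finset.sum_nonneg fun x _ => mul_nonneg (hp x) (hF f hf x).1
    have hμ1 : μ ≤ 1 := by
      rw [← hp1]
      exact Finset.sum_le_sum fun x _ => mul_le_of_le_one_right (hp x) (hF f hf x).2
    refine (half_le_sum_concentrated hp hp1 (fun x => f x - μ) ?_ (fun x => ?_) hN hε h8).trans ?_
    · simp only [mul_sub, Finset.sum_sub_distrib, ← Finset.sum_mul, hp1, one_mul]
      exact sub_self μ
    · have := hF f hf x
      rw [abs_le]
      constructor <;> linarith [this.1, this.2]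
    · rw [Finset.sum_filter]
      refine Finset.sum_le_sum fun s' _ => ?_
      split_ifs with h1 h2 h2
      · rw [mul_one]
      · refine absurd ⟨f, hf, ?_⟩ h2
        have h3 : ∑ i, (f (s i) - f (s' i)) = ∑ i, (f (s i) - μ) - ∑ i, (f (s' i) - μ) := by
          rw [← Finset.sum_sub_distrib]
          exact Finset.sum_congr rfl fun i _ => by ring
        have h4 := abs_sub_abs_le_abs_sub (∑ i, (f (s i) - μ)) (∑ i, (f (s' i) - μ))
        rw [← h3] at h4
        change N * ε / 2 < |∑ i, (f (s i) - f (s' i))|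
        linarith
      · rw [mul_one]; exact hnn s'
      · rw [mul_zero]
  have hdis := sum_exists_disagree_le hp hp1 hF hd1 hd hN hε hl hNε E fun z hz => hz
  have hhalf : (∑ s ∈ B, ∏ i, p (s i)) * (1 / 2) ≤ Real.exp (-l) / 2 := by
    refine le_trans ?_ hdis
    rw [Finset.sum_mul, Fintype.sum_prod_type]
    calc ∑ s ∈ B, (∏ i, p (s i)) * (1 / 2)
        ≤ ∑ s ∈ B, (∏ i, p (s i)) *
          ∑ s' : Fin N → X, (∏ i, p (s' i)) * (if E (s, s') then 1 else 0) :=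
          Finset.sum_le_sum fun s hs => mul_le_mul_of_nonneg_left (hghost s hs) (hnn s)
      _ ≤ ∑ s, (∏ i, p (s i)) *
          ∑ s' : Fin N → X, (∏ i, p (s' i)) * (if E (s, s') then 1 else 0) := by
          refine Finset.sum_le_sum_of_subset_of_nonneg (Finset.subset_univ _) fun s _ _ => ?_
          refine mul_nonneg (hnn s) (Finset.sum_nonneg fun s' _ => mul_nonneg (hnn s') ?_)
          split_ifs <;> norm_num
      _ = _ := by simp only [Finset.mul_sum, mul_assoc]
  linarith

end FiniteSampling

lemma sum_support_p {α : Type*} (D : FinDist α) :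
    ∑ x : D.finite_support.toFinset, D.p x = 1 := by
  rw [← D.total, finsum_eq_sum_of_support_subset (s := D.finite_support.toFinset) _ (by simp)]
  exact Finset.sum_coe_sort _ _

lemma expect_eq_sum {α : Type*} (D : FinDist α) (g : α → ℝ) :
    expect D g = ∑ x : D.finite_support.toFinset, D.p x * g x := by
  rw [expect, finsum_eq_sum_of_support_subset (s := D.finite_support.toFinset)]
  · exact (Finset.sum_coe_sort _ fun x => D.p x * g x).symm
  · intro x hx
    simp only [Set.Finite.coe_toFinset, Function.mem_support] at hx ⊢
    exact left_ne_zero_of_mul hx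

lemma expect_mono {α : Type*} (D : FinDist α) {g h : α → ℝ} (hgh : ∀ a, g a ≤ h a) :
    expect D g ≤ expect D h := by
  rw [expect_eq_sum, expect_eq_sum]
  exact Finset.sum_le_sum fun x _ => mul_le_mul_of_nonneg_left (hgh x) (D.nonneg x)

lemma expect_affine {α : Type*} (D : FinDist α) (g : α → ℝ) (a b : ℝ) :
    expect D (fun x => a * g x + b) = a * expect D g + b := by
  rw [expect_eq_sum, expect_eq_sum, Finset.mul_sum]
  calc _ = ∑ x : D.finite_support.toFinset, (a * (D.p x * g x) + D.p x * b) :=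
        Finset.sum_congr rfl fun x _ => by ring
    _ = _ := by rw [Finset.sum_add_distrib, ← Finset.sum_mul, sum_support_p, one_mul]

lemma prodProb_eq_sum {α : Type*} (D : FinDist α) (N : ℕ) (E : Set (Fin N → α))
    [DecidablePred fun s : Fin N → D.finite_support.toFinset => (fun i => (s i : α)) ∈ E] :
    prodProb D N E =
      ∑ s : Fin N → D.finite_support.toFinset with (fun i => (s i : α)) ∈ E,
        ∏ i, D.p (s i) := by
  classical
  let e : (Fin N → D.finite_support.toFinset) ↪ (Fin N → α) :=
    ⟨fun s i => s i, fun s s' h => funext fun i => Subtype.ext (congrFun h i)⟩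
  rw [prodProb, finsum_mem_def,
    finsum_eq_sum_of_support_subset (s := Finset.univ.map e), Finset.sum_map, Finset.sum_filter]
  · refine Finset.sum_congr rfl fun s _ => ?_
    rw [Set.indicator_apply]
    rfl
  · intro s hs
    rw [Set.support_indicator] at hs
    have hne := Finset.prod_ne_zero_iff.1 hs.2
    rw [Finset.coe_map]
    exact ⟨fun i => ⟨s i, by simpa using hne i (Finset.mem_univ i)⟩, by simp, rfl⟩

lemma prodProb_univ {α : Type*} (D : FinDist α) (N : ℕ) :
    prodProb D N Set.univ = 1 := by
  classical
  rw [prodProb_eq_sum]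
  simpa using sum_prod_weights (sum_support_p D) N

/-- With high probability, sample averages are uniformly close to expectations over a class of
pseudo-dimension at most `d`. -/
lemma one_sub_le_prodProb {α : Type*} (D : FinDist α) {F : Set (α → ℝ)}
    (hF : ∀ f ∈ F, ∀ x, f x ∈ Set.Icc (0 : ℝ) 1) {d : ℕ} (hd1 : 1 ≤ d)
    (hd : ∀ k, PseudoShatters F k → k ≤ d) {N : ℕ} (hN : 0 < N) {ε l : ℝ} (hε : 0 < ε)
    (hl : 0 ≤ l) (hNε : 4096 * (27 * d + l) ≤ N * ε ^ 2) (E : Set (Fin N → α))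
    (hE : ∀ s, (∀ f ∈ F, |∑ i, (f (s i) - expect D f)| ≤ N * ε) → s ∈ E) :
    1 - Real.exp (-l) ≤ prodProb D N E := by
  classical
  rw [prodProb_eq_sum]
  have hsplit := Finset.sum_filter_add_sum_filter_not
    (Finset.univ : Finset (Fin N → D.finite_support.toFinset))
    (fun s => (fun i => (s i : α)) ∈ E) (fun s => ∏ i, D.p (s i))
  rw [sum_prod_weights (p := fun x : D.finite_support.toFinset => D.p x)
    (sum_support_p D)] at hsplit
  have hbad := sum_exists_deviation_le (X := D.finite_support.toFinset)
    (p := fun x => D.p x) (fun x => D.nonneg x) (sum_support_p D)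
    (F := (fun f x => f (x : α)) '' F) ?_ hd1 ?_ hN hε hl hNε
    (Finset.univ.filter fun s => ¬ (fun i => (s i : α)) ∈ E) ?_
  · linarith
  · rintro _ ⟨f, hf, rfl⟩ x
    exact hF f hf x
  · rintro k ⟨x, τ, h⟩
    refine hd k ⟨fun j => x j, τ, fun S => ?_⟩
    obtain ⟨_, ⟨f, hf, rfl⟩, hS⟩ := h S
    exact ⟨f, hf, hS⟩
  · intro s hs
    have hns := fun h => (Finset.mem_filter.1 hs).2 (hE _ h)
    by_contra! hcon
    refine hns fun f hf => ?_
    have := hcon _ ⟨f, hf, rfl⟩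
    rwa [expect_eq_sum]

lemma uPa_mem_Icc {n m : ℕ} {r t : Fin m → ℝ} (hr0 : ∀ j, 0 ≤ r j) (hr1 : ∀ j, r j ≤ 1)
    (ht : t ∈ Cbounded m) (θ : AgentType n m) (i : Fin n) :
    uPa r θ t i ∈ Set.Icc (-1 : ℝ) 1 := by
  have hsum := θ.f_sum i
  have hterm : ∀ j, -θ.f i j ≤ θ.f i j * (r j - t j) ∧ θ.f i j * (r j - t j) ≤ θ.f i j := by
    intro j
    have hf := θ.f_nonneg i j
    obtain ⟨h0, h1⟩ := ht j
    constructor <;> nlinarith [hr0 j, hr1 j]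
  constructor
  · rw [← hsum, ← Finset.sum_neg_distrib]
    exact Finset.sum_le_sum fun j _ => (hterm j).1
  · rw [← hsum]
    exact Finset.sum_le_sum fun j _ => (hterm j).2

lemma uP_mem_Icc {n m : ℕ} (hn : 1 ≤ n) {r t : Fin m → ℝ} (hr0 : ∀ j, 0 ≤ r j)
    (hr1 : ∀ j, r j ≤ 1) (ht : t ∈ Cbounded m) (θ : AgentType n m) :
    uP r θ t ∈ Set.Icc (-1 : ℝ) 1 := by
  have : Nonempty (Fin n) := ⟨⟨0, hn⟩⟩
  obtain ⟨i, hi⟩ := Finite.exists_max (uA θ t)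
  have hne : (uPa r θ t '' BestResp θ t).Nonempty := ⟨_, i, hi, rfl⟩
  obtain ⟨i', -, h⟩ := hne.csSup_mem (Set.toFinite _)
  rw [uP, ← h]
  exact uPa_mem_Icc hr0 hr1 ht θ i'

/-- If empirical averages over the approximating class are uniformly within `ε / 3` of
expectations, then approximate empirical optimality implies approximate optimality. -/
lemma expect_ge_of_uniformly_close {n m N : ℕ} (hn : 1 ≤ n) (hN : 0 < N) {r : Fin m → ℝ}
    (hr0 : ∀ j, 0 ≤ r j) (hr1 : ∀ j, r j ≤ 1) {ε ρ : ℝ}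
    {Cbar C : Set (Fin m → ℝ)} (hCbar : Cbar ⊆ Cbounded m) (happ : IsApprox n r Cbar C (ε / 3))
    (D : FinDist (AgentType n m)) (s : Fin N → AgentType n m)
    (hclose : ∀ t ∈ Cbar,
      |(1 / (N : ℝ)) * ∑ i, uP r (s i) t - expect D fun θ => uP r θ t| ≤ ε / 3)
    {t : Fin m → ℝ} (ht : t ∈ Cbar)
    (hopt : (1 / (N : ℝ)) * ∑ i, uP r (s i) t ≥
      sSup ((fun t' => (1 / (N : ℝ)) * ∑ i, uP r (s i) t') '' Cbar) - ρ) :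
    expect D (fun θ => uP r θ t) ≥ OPT C r D - ε - ρ := by
  have hN' : (0 : ℝ) < N := by exact_mod_cast hN
  have hbdd : BddAbove ((fun t' => (1 / (N : ℝ)) * ∑ i, uP r (s i) t') '' Cbar) := by
    refine ⟨1, ?_⟩
    rintro _ ⟨t', ht', rfl⟩
    have h : ∑ i, uP r (s i) t' ≤ ∑ _i : Fin N, (1 : ℝ) :=
      Finset.sum_le_sum fun i _ => (uP_mem_Icc hn hr0 hr1 (hCbar ht') (s i)).2
    simp only [Finset.sum_const, Finset.card_univ, Fintype.card_fin, nsmul_eq_mul, mul_one] at h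
    change 1 / (N : ℝ) * ∑ i, uP r (s i) t' ≤ 1
    rw [one_div, inv_mul_le_iff₀ hN', mul_one]
    exact h
  have hOPT : OPT Cbar r D ≤ expect D (fun θ => uP r θ t) + 2 * (ε / 3) + ρ := by
    refine csSup_le ⟨_, t, ht, rfl⟩ ?_
    rintro _ ⟨t', ht', rfl⟩
    have h1 := le_csSup hbdd ⟨t', ht', rfl⟩
    have h2 := (abs_le.1 (hclose t ht)).2
    have h3 := (abs_le.1 (hclose t' ht')).1
    simp only at h1 ⊢
    linarith
  have := happ D
  linarith

lemma pseudoShatters_uP {n m : ℕ} {r : Fin m → ℝ} {C : Set (Fin m → ℝ)} {k : ℕ}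
    (h : PseudoShatters ((fun t (θ : AgentType n m) => 1 / 2 * uP r θ t + 1 / 2) '' C) k) :
    Shatters r C (Set.univ : Set (AgentType n m)) k := by
  obtain ⟨θ, τ, h⟩ := h
  refine ⟨θ, fun _ => Set.mem_univ _, fun j => 2 * τ j - 1, fun S => ?_⟩
  obtain ⟨_, ⟨t, ht, rfl⟩, h1, h2⟩ := h S
  refine ⟨t, ht, fun j hj => ?_, fun j hj => ?_⟩
  · have := h1 j hj
    linarith
  · have := h2 j hj
    linarith

/-- In a class of pseudo-dimension zero all contracts have the same utility. -/
lemma uP_eq_of_not_shatters_one {n m : ℕ} {r : Fin m → ℝ} {C : Set (Fin m → ℝ)}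
    (h : ¬ Shatters r C (Set.univ : Set (AgentType n m)) 1) {t t' : Fin m → ℝ}
    (ht : t ∈ C) (ht' : t' ∈ C) (θ : AgentType n m) : uP r θ t = uP r θ t' := by
  have key : ∀ t ∈ C, ∀ t' ∈ C, uP r θ t ≤ uP r θ t' := by
    intro t ht t' ht'
    by_contra! hlt
    refine h ⟨fun _ => θ, fun _ => Set.mem_univ _, fun _ => uP r θ t, fun S => ?_⟩
    by_cases hS : (0 : Fin 1) ∈ S
    · refine ⟨t, ht, fun j _ => le_rfl, fun j hj => ?_⟩
      rw [Subsingleton.elim j 0] at hj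
      exact absurd hS hj
    · refine ⟨t', ht', fun j hj => ?_, fun j _ => hlt⟩
      rw [Subsingleton.elim j 0] at hj
      exact absurd hj hS
  exact le_antisymm (key t ht t' ht') (key t' ht' t ht)

/-- Learning with an approximation oracle. With rewards at most `1`,
there is an absolute constant `A > 0` such that if `C̄ ⊆ C ⊆ C_bounded`, `C̄` is an
`(ε/3)`-approximation of `C`, `d` bounds the pseudo-dimension of `C̄`, and
`N ≥ A·(1/ε²)·(d + log(1/δ))`, then for every finitely supported `D`, with probability
at least `1 − δ` over an i.i.d. sample of size `N`, every `ρ`-empirically-optimal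
contract of `C̄` is `(ε + ρ)`-optimal for `C` on `D`. -/
theorem stmt_10 : ∃ A : ℝ, 0 < A ∧
    ∀ (n m : ℕ), 1 ≤ n → 2 ≤ m → ∀ r : Fin m → ℝ,
      (∀ j, 0 ≤ r j) → (∀ j : Fin m, (j : ℕ) = 0 → r j = 0) → (∀ j, r j ≤ 1) →
      ∀ ε δ ρ : ℝ, 0 < ε → ε < 1 → 0 < δ → δ < 1 → 0 ≤ ρ →
      ∀ Cbar C : Set (Fin m → ℝ), Cbar ⊆ C → C ⊆ Cbounded m →
        IsApprox n r Cbar C (ε / 3) →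
      ∀ d : ℕ, (∀ k : ℕ, Shatters r Cbar (Set.univ : Set (AgentType n m)) k → k ≤ d) →
      ∀ N : ℕ, (N : ℝ) ≥ A * (1/ε^2) * ((d : ℝ) + Real.log (1/δ)) →
      ∀ D : FinDist (AgentType n m),
        prodProb D N {s | ∀ t ∈ Cbar,
            (1/(N:ℝ)) * ∑ i, uP r (s i) t ≥
              sSup ((fun t' => (1/(N:ℝ)) * ∑ i, uP r (s i) t') '' Cbar) - ρ →
            expect D (fun θ => uP r θ t) ≥ OPT C r D - ε - ρ} ≥ 1 - δ := by
  refine ⟨4096 * 27 * 36, by norm_num, ?_⟩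
  intro n m hn _ r hr0 _ hr1 ε δ ρ hε _ hδ hδ1 hρ Cbar C hsub hC happ d hd N hN D
  have hCbar := hsub.trans hC
  have hl : 0 ≤ Real.log (1 / δ) := Real.log_nonneg (by rw [le_div_iff₀ hδ]; linarith)
  rcases Nat.eq_zero_or_pos d with rfl | hd1
  · have hconst : ¬ Shatters r Cbar (Set.univ : Set (AgentType n m)) 1 := fun h => by
      simpa using hd 1 h
    refine le_trans (by linarith : 1 - δ ≤ 1) ?_
    rw [← prodProb_univ D N]
    refine le_of_eq (congrArg _ (Set.eq_univ_of_forall fun s t ht _ => ?_).symm)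
    have hOPT : OPT Cbar r D ≤ expect D (fun θ => uP r θ t) := by
      refine csSup_le ⟨_, t, ht, rfl⟩ ?_
      rintro _ ⟨t', ht', rfl⟩
      exact expect_mono D fun θ => (uP_eq_of_not_shatters_one hconst ht' ht θ).le
    have := happ D
    linarith
  · have hd1' : (1 : ℝ) ≤ d := by exact_mod_cast hd1
    have hN1 : 4096 * 27 * 36 * (d + Real.log (1 / δ)) ≤ N * ε ^ 2 := by
      have h := mul_le_mul_of_nonneg_right hN (sq_nonneg ε)
      refine le_trans (le_of_eq ?_) h
      field_simp
    have hN0 : 0 < N := by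
      rcases Nat.eq_zero_or_pos N with rfl | h
      · norm_num at hN1
        norm_num at hl
        linarith
      · exact h
    have hN' : (0 : ℝ) < N := by exact_mod_cast hN0
    have hexp : Real.exp (-Real.log (1 / δ)) = δ := by
      rw [one_div, Real.log_inv, neg_neg, Real.exp_log hδ]
    refine (congrArg (1 - ·) hexp).ge.trans (one_sub_le_prodProb D
      (F := (fun t (θ : AgentType n m) => 1 / 2 * uP r θ t + 1 / 2) '' Cbar)
      ?_ hd1 (fun k hk => hd k (pseudoShatters_uP hk)) hN0 (ε := ε / 6) (by positivity) hl
      (by linarith) _ fun s hs t ht =>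
        expect_ge_of_uniformly_close (ρ := ρ) hn hN0 hr0 hr1 hCbar happ D s ?_ ht)
    · rintro _ ⟨t, ht, rfl⟩ θ
      have := uP_mem_Icc hn hr0 hr1 (hCbar ht) θ
      constructor <;> linarith [this.1, this.2]
    · intro t' ht'
      have h := hs _ ⟨t', ht', rfl⟩
      simp only [expect_affine] at h
      have heq : ∑ i, (1 / 2 * uP r (s i) t' + 1 / 2 -
          (1 / 2 * expect D (fun θ => uP r θ t') + 1 / 2)) =
          N / 2 * ((1 / (N : ℝ)) * ∑ i, uP r (s i) t' - expect D fun θ => uP r θ t') := by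
        simp only [Finset.sum_sub_distrib, Finset.sum_add_distrib, ← Finset.mul_sum,
          Finset.sum_const, Finset.card_univ, Fintype.card_fin, nsmul_eq_mul]
        field_simp
        ring
      rw [heq, abs_mul, abs_of_pos (by positivity : (0 : ℝ) < N / 2)] at h
      have : N / 2 * |(1 / (N : ℝ)) * ∑ i, uP r (s i) t' - expect D fun θ => uP r θ t'| ≤
          N / 2 * (ε / 3) := h.trans_eq (by ring)
      exact le_of_mul_le_mul_left this (by positivity)
end

section
/- Fix 0 < ε < 1/4 and 0 < δ < 1/2, and let D_1 = Ber(1/2 − ε) and D_2 = Ber(1/2 + ε). If a function 𝒜 : {0,1}^N → {1,2} satisfies P_{x∼D_i^N}[𝒜(x) = i] ≥ 1 − δ for both i = 1 and i = 2, then N ≥ (1/(16·ε²))·ln(1/(4δ)). -/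
open scoped BigOperators

/-- The Bernoulli distribution on `Bool` assigning probability `p` to `true`. -/
noncomputable def ber (p : ℝ) : Bool → ℝ := fun b => if b then p else 1 - p

/-- Probability of an event under `N` i.i.d. samples from a pmf `q` on a type `α`. -/
noncomputable def prodProbPmf {α : Type*} (q : α → ℝ) (N : ℕ) (E : Set (Fin N → α)) : ℝ :=
  ∑ᶠ x ∈ E, ∏ i, q (x i)

lemma sum_prod_ber (p : ℝ) (N : ℕ) : ∑ x : Fin N → Bool, ∏ i, ber p (x i) = 1 := by
  rw [← Fintype.prod_sum (fun _ : Fin N => ber p)]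
  simp [ber]

lemma ber_nonneg {p : ℝ} (h0 : 0 ≤ p) (h1 : p ≤ 1) (b : Bool) : 0 ≤ ber p b := by
  cases b <;> simp [ber, h0, h1]

lemma prodProbPmf_eq_sum_filter {N : ℕ} (q : Bool → ℝ) (A : (Fin N → Bool) → Fin 2) (k : Fin 2) :
    prodProbPmf q N {x | A x = k} = ∑ x with A x = k, ∏ i, q (x i) := by
  rw [prodProbPmf, ← finsum_mem_coe_finset]
  simp

/-- The likelihoods of a sample under the two biased coins have constant product. -/
lemma prod_ber_mul_prod_ber (ε : ℝ) {N : ℕ} (x : Fin N → Bool) :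
    (∏ i, ber (1/2 - ε) (x i)) * ∏ i, ber (1/2 + ε) (x i) = (1/4 - ε^2) ^ N := by
  rw [← Finset.prod_mul_distrib, Finset.prod_congr rfl (g := fun _ => 1/4 - ε^2)]
  · simp
  · intro i _
    cases x i <;> simp [ber] <;> ring

/-- Cauchy-Schwarz bound for an event that has small probability under one of two
nonnegative weights of total mass one and constant pointwise product `c ^ 2`. -/
lemma card_mul_sq_le {α : Type*} [Fintype α] (S : Finset α) {P Q : α → ℝ} {c δ : ℝ}
    (hP : ∀ x, 0 ≤ P x) (hQ : ∀ x, 0 ≤ Q x) (hPs : ∑ x, P x = 1)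
    (hc : ∀ x, c ^ 2 = P x * Q x) (hS : ∑ x ∈ S, Q x ≤ δ) :
    (S.card * c) ^ 2 ≤ δ := by
  have h := Finset.sum_sq_le_sum_mul_sum_of_sq_le_mul S (r := fun _ => c) (f := P) (g := Q)
    (fun x _ => hP x) (fun x _ => hQ x) (fun x _ => (hc x).le)
  have hP1 : ∑ x ∈ S, P x ≤ 1 :=
    hPs ▸ Finset.sum_le_univ_sum_of_nonneg hP
  have hQ0 : 0 ≤ ∑ x ∈ S, Q x := Finset.sum_nonneg fun x _ => hQ x
  rw [Finset.sum_const, nsmul_eq_mul] at h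
  nlinarith

/-- Distinguishing `Ber(1/2 − ε)` from `Ber(1/2 + ε)` with failure
probability at most `δ` requires `N ≥ (1/(16ε²))·ln(1/(4δ))` samples. -/
theorem stmt_13 (ε δ : ℝ) (hε0 : 0 < ε) (hε : ε < 1/4) (hδ0 : 0 < δ) (hδ : δ < 1/2)
    (N : ℕ) (𝒜 : (Fin N → Bool) → Fin 2)
    (h1 : prodProbPmf (ber (1/2 - ε)) N {x | 𝒜 x = 0} ≥ 1 - δ)
    (h2 : prodProbPmf (ber (1/2 + ε)) N {x | 𝒜 x = 1} ≥ 1 - δ) :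
    (N : ℝ) ≥ (1/(16 * ε^2)) * Real.log (1/(4*δ)) := by
  rw [prodProbPmf_eq_sum_filter] at h1 h2
  have hcompl : ∀ x, 𝒜 x = 1 ↔ ¬ 𝒜 x = 0 := fun x => by omega
  simp only [hcompl] at h2
  set P : (Fin N → Bool) → ℝ := fun x => ∏ i, ber (1/2 - ε) (x i)
  set Q : (Fin N → Bool) → ℝ := fun x => ∏ i, ber (1/2 + ε) (x i)
  have hP : ∀ x, 0 ≤ P x := fun x =>
    Finset.prod_nonneg fun i _ => ber_nonneg (by linarith) (by linarith) _
  have hQ : ∀ x, 0 ≤ Q x := fun x =>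
    Finset.prod_nonneg fun i _ => ber_nonneg (by linarith) (by linarith) _
  have hPs : ∑ x, P x = 1 := sum_prod_ber _ N
  have hQs : ∑ x, Q x = 1 := sum_prod_ber _ N
  have hbase : 0 < 1/4 - ε^2 := by nlinarith
  set c := √((1/4 - ε^2) ^ N)
  have hc2 : c ^ 2 = (1/4 - ε^2) ^ N := Real.sq_sqrt (by positivity)
  have hc : ∀ x, c ^ 2 = P x * Q x := fun x => hc2.trans (prod_ber_mul_prod_ber ε x).symm
  have hPsplit := Finset.sum_filter_add_sum_filter_not Finset.univ (fun x => 𝒜 x = 0) P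
  have hQsplit := Finset.sum_filter_add_sum_filter_not Finset.univ (fun x => 𝒜 x = 0) Q
  have hcard := Finset.card_filter_add_card_filter_not
    (s := (Finset.univ : Finset (Fin N → Bool))) (fun x => 𝒜 x = 0)
  have ha := card_mul_sq_le (Finset.univ.filter fun x => 𝒜 x = 0) hP hQ hPs hc
    (δ := δ) (by linarith)
  have hb := card_mul_sq_le (Finset.univ.filter fun x => ¬ 𝒜 x = 0) hQ hP hQs
    (fun x => (hc x).trans (mul_comm _ _)) (δ := δ) (by linarith)
  have hcard' : ((Finset.univ.filter fun x => 𝒜 x = 0).card : ℝ)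
      + (Finset.univ.filter fun x => ¬ 𝒜 x = 0).card = 2 ^ N := by
    rw [← Nat.cast_add, hcard]
    simp
  have hpow : (1 - 4 * ε^2) ^ N ≤ 4 * δ := by
    have h4 : (1 - 4 * ε^2) ^ N = (2 ^ N * c) ^ 2 := by
      rw [mul_pow, hc2, ← pow_mul, mul_comm N 2, pow_mul, ← mul_pow]
      ring
    rw [h4, ← hcard', add_mul]
    linarith [add_sq_le (a := (Finset.univ.filter fun x => 𝒜 x = 0).card * c)
      (b := (Finset.univ.filter fun x => ¬ 𝒜 x = 0).card * c)]
  have hpos : 0 < 1 - 4 * ε^2 := by linarith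
  have hlog := Real.log_le_log (by positivity) hpow
  rw [Real.log_pow] at hlog
  have hlog1 : -(16 * ε^2) ≤ Real.log (1 - 4 * ε^2) := by
    refine le_trans ?_ (Real.one_sub_inv_le_log_of_pos hpos)
    have hinv : (1 - 4 * ε^2)⁻¹ ≤ 1 + 16 * ε^2 := by
      rw [inv_le_iff_one_le_mul₀ hpos]
      nlinarith [mul_nonneg (sq_nonneg ε) (show (0:ℝ) ≤ 1/16 - ε^2 by nlinarith)]
    linarith
  have hN := mul_le_mul_of_nonneg_left hlog1 (Nat.cast_nonneg (α := ℝ) N)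
  rw [one_div (4 * δ), Real.log_inv, ge_iff_le, one_div_mul_eq_div, div_le_iff₀ (by positivity)]
  linarith
end
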